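/- arXiv:2303.04002 — 2 statements merged into one kernel-verified Lean document; each statement's English description precedes it below -/
import Mathlib

section
/- Let σ > 0, Δ > σ, and let μ be a nonzero real number. Then there exists a real λ with |λ| > 2σ, sign(λ) = sign(μ), and λ − μ = Δ²·𝔤_σ(λ) if and only if |μ| > 2σ − Δ²/σ. In that case this solution is unique and is given by λ = (2μσ² − Δ²μ − sign(μ)·Δ²·√(μ² + 4(Δ² − σ²))) / (2(σ² − Δ²)). -/
/-- The Stieltjes transform of the semicircle law of variance `s ^ 2`,
    `𝔤_s(l) = (l - sign(l) * √(l² - 4 s²)) / (2 s²)`, for real `l` with `|l| > 2 s`. -/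
noncomputable def stieltjes (s l : ℝ) : ℝ :=
  (l - Real.sign l * Real.sqrt (l ^ 2 - 4 * s ^ 2)) / (2 * s ^ 2)

theorem stieltjes_neg (s l : ℝ) : stieltjes s (-l) = -stieltjes s l := by
  simp only [stieltjes, Real.sign_neg, neg_sq]
  ring

/-- The Joukowski parametrization `u ↦ u + s² / u` inverts the Stieltjes transform. -/
theorem stieltjes_joukowski {s u : ℝ} (hs : 0 < s) (hu : s < u) :
    stieltjes s (u + s ^ 2 / u) = 1 / u := by
  have hu0 : 0 < u := hs.trans hu
  have hsq : Real.sqrt ((u + s ^ 2 / u) ^ 2 - 4 * s ^ 2) = u - s ^ 2 / u := by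
    have hnn : 0 ≤ u - s ^ 2 / u := by
      rw [sub_nonneg, div_le_iff₀ hu0]
      nlinarith
    rw [← Real.sqrt_sq hnn]
    congr 1
    field_simp
    ring
  rw [stieltjes, hsq, Real.sign_of_pos (by positivity)]
  field_simp
  ring

theorem two_mul_lt_joukowski {s u : ℝ} (hs : 0 < s) (hu : s < u) :
    2 * s < u + s ^ 2 / u := by
  have hu0 : 0 < u := hs.trans hu
  have h : u + s ^ 2 / u - 2 * s = (u - s) ^ 2 / u := by
    field_simp
    ring
  have : 0 < (u - s) ^ 2 / u := div_pos (pow_pos (sub_pos.2 hu) 2) hu0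
  linarith

theorem exists_joukowski {s l : ℝ} (hs : 0 < s) (hl : 2 * s < l) :
    ∃ u, s < u ∧ l = u + s ^ 2 / u := by
  have hr := Real.sqrt_nonneg (l ^ 2 - 4 * s ^ 2)
  have hr2 := Real.sq_sqrt (show 0 ≤ l ^ 2 - 4 * s ^ 2 by nlinarith)
  set r := Real.sqrt (l ^ 2 - 4 * s ^ 2)
  have hu : s < (l + r) / 2 := by linarith
  have hu0 : 0 < (l + r) / 2 := hs.trans hu
  refine ⟨(l + r) / 2, hu, ?_⟩
  rw [← sub_eq_iff_eq_add', eq_div_iff hu0.ne']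
  linarith [show (l - (l + r) / 2) * ((l + r) / 2) = (l ^ 2 - r ^ 2) / 4 by ring]

theorem joukowski_sub_eq_iff {σ Δ μ u : ℝ} (hσ : 0 < σ) (hu : σ < u) :
    u + σ ^ 2 / u - μ = Δ ^ 2 * stieltjes σ (u + σ ^ 2 / u) ↔
      u ^ 2 - μ * u = Δ ^ 2 - σ ^ 2 := by
  have hu0 : 0 < u := hσ.trans hu
  rw [stieltjes_joukowski hσ hu]
  field_simp
  constructor <;> intro h <;> linarith

/-- A positive root `u` of `u² - μ u = c` is the larger one. -/
theorem sqrt_discrim_of_sq_sub_mul_eq {μ c u : ℝ} (hc : 0 < c) (hu : 0 < u) (h : u ^ 2 - μ * u = c) :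
    Real.sqrt (μ ^ 2 + 4 * c) = 2 * u - μ := by
  have hnn : 0 ≤ 2 * u - μ := by
    have : 0 < u - μ := pos_of_mul_pos_right (show 0 < u * (u - μ) by nlinarith) hu.le
    linarith
  rw [← Real.sqrt_sq hnn]
  congr 1
  linarith

theorem exists_sub_eq_stieltjes_iff {σ Δ μ : ℝ} (hσ : 0 < σ) (hΔσ : σ < Δ) :
    (∃ l, 2 * σ < l ∧ l - μ = Δ ^ 2 * stieltjes σ l) ↔ 2 * σ - Δ ^ 2 / σ < μ := by
  have hc : 0 < Δ ^ 2 - σ ^ 2 := by nlinarith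
  have hthr : 2 * σ - Δ ^ 2 / σ < μ ↔ σ ^ 2 - μ * σ < Δ ^ 2 - σ ^ 2 := by
    rw [sub_lt_comm, lt_div_iff₀ hσ]
    constructor <;> intro h <;> linarith
  rw [hthr]
  constructor
  · rintro ⟨l, hl, h⟩
    obtain ⟨u, hu, rfl⟩ := exists_joukowski hσ hl
    rw [joukowski_sub_eq_iff hσ hu] at h
    have : 0 < u - μ := pos_of_mul_pos_right
      (show 0 < u * (u - μ) by nlinarith) (hσ.trans hu).le
    nlinarith
  · intro h
    have hr := Real.sqrt_nonneg (μ ^ 2 + 4 * (Δ ^ 2 - σ ^ 2))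
    have hr2 := Real.sq_sqrt (show 0 ≤ μ ^ 2 + 4 * (Δ ^ 2 - σ ^ 2) by positivity)
    set r := Real.sqrt (μ ^ 2 + 4 * (Δ ^ 2 - σ ^ 2))
    have hu : σ < (μ + r) / 2 := by
      have : 2 * σ - μ < r := lt_of_pow_lt_pow_left₀ 2 hr (by linarith)
      linarith
    refine ⟨_, two_mul_lt_joukowski hσ hu, (joukowski_sub_eq_iff hσ hu).2 ?_⟩
    linarith

theorem eq_of_sub_eq_stieltjes {σ Δ μ l : ℝ} (hσ : 0 < σ) (hΔσ : σ < Δ) (hl : 2 * σ < l)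
    (h : l - μ = Δ ^ 2 * stieltjes σ l) :
    l = (2 * μ * σ ^ 2 - Δ ^ 2 * μ - Δ ^ 2 * Real.sqrt (μ ^ 2 + 4 * (Δ ^ 2 - σ ^ 2))) /
      (2 * (σ ^ 2 - Δ ^ 2)) := by
  have hc : 0 < Δ ^ 2 - σ ^ 2 := by nlinarith
  obtain ⟨u, hu, rfl⟩ := exists_joukowski hσ hl
  rw [joukowski_sub_eq_iff hσ hu] at h
  have hu0 : 0 < u := hσ.trans hu
  rw [sqrt_discrim_of_sq_sub_mul_eq hc hu0 h, eq_div_iff (by linarith)]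
  field_simp
  linear_combination (2 * σ ^ 2) * h

theorem stmt_3 (σ Δ μ : ℝ) (hσ : 0 < σ) (hΔσ : σ < Δ) (hμ : μ ≠ 0) :
    ((∃ l : ℝ, 2 * σ < |l| ∧ Real.sign l = Real.sign μ ∧ l - μ = Δ ^ 2 * stieltjes σ l) ↔
      2 * σ - Δ ^ 2 / σ < |μ|) ∧
    (∀ l : ℝ, 2 * σ < |l| → Real.sign l = Real.sign μ → l - μ = Δ ^ 2 * stieltjes σ l →
      l = (2 * μ * σ ^ 2 - Δ ^ 2 * μ -
            Real.sign μ * Δ ^ 2 * Real.sqrt (μ ^ 2 + 4 * (Δ ^ 2 - σ ^ 2))) /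
          (2 * (σ ^ 2 - Δ ^ 2))) := by
  have sign_eq_one {l : ℝ} : Real.sign l = 1 ↔ 0 < l := by
    rcases lt_trichotomy l 0 with h | rfl | h
    · rw [Real.sign_of_neg h]
      constructor <;> intro <;> linarith
    · simp
    · simp [Real.sign_of_pos h, h]
  rcases hμ.lt_or_gt with h | h
  · have sign_eq_neg_one {l : ℝ} : Real.sign l = -1 ↔ l < 0 := by
      rw [← neg_pos, ← sign_eq_one, Real.sign_neg, neg_eq_iff_eq_neg]
    simp only [Real.sign_of_neg h, sign_eq_neg_one, abs_of_neg h]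
    refine ⟨?_, fun l hl hl0 heq => ?_⟩
    · rw [← exists_sub_eq_stieltjes_iff hσ hΔσ]
      constructor
      · rintro ⟨l, hl, hl0, heq⟩
        rw [abs_of_neg hl0] at hl
        exact ⟨-l, hl, by rw [stieltjes_neg]; linarith⟩
      · rintro ⟨l, hl, heq⟩
        have hl0 : 0 < l := by linarith
        exact ⟨-l, by rwa [abs_neg, abs_of_pos hl0], neg_lt_zero.2 hl0,
          by rw [stieltjes_neg]; linarith⟩
    · rw [abs_of_neg hl0] at hl
      have key := eq_of_sub_eq_stieltjes (μ := -μ) hσ hΔσ hl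
        (by rw [stieltjes_neg]; linarith)
      rw [neg_sq] at key
      rw [← neg_neg l, key, ← neg_div]
      ring_nf
  · simp only [Real.sign_of_pos h, sign_eq_one, abs_of_pos h, one_mul]
    refine ⟨?_, fun l hl hl0 heq => ?_⟩
    · rw [← exists_sub_eq_stieltjes_iff hσ hΔσ]
      constructor
      · rintro ⟨l, hl, hl0, heq⟩
        exact ⟨l, by rwa [abs_of_pos hl0] at hl, heq⟩
      · rintro ⟨l, hl, heq⟩
        have hl0 : 0 < l := by linarith
        exact ⟨l, by rwa [abs_of_pos hl0], hl0, heq⟩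
    · rw [abs_of_pos hl0] at hl
      exact eq_of_sub_eq_stieltjes hσ hΔσ hl heq
end

section
/- Let σ_H, σ_W > 0 and set σ = √(σ_H² + σ_W²). Then for every real z > 2σ: (1 − σ_W²·𝔤_σ′(z)) · (1 − σ²·𝔤_σ(z)²) = 1 − σ_H²·𝔤_σ(z)², where 𝔤_σ′(z) denotes the derivative of 𝔤_σ at z. -/
theorem stieltjes_of_pos (s : ℝ) {l : ℝ} (hl : 0 < l) :
    stieltjes s l = (l - Real.sqrt (l ^ 2 - 4 * s ^ 2)) / (2 * s ^ 2) := by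
  rw [stieltjes, Real.sign_of_pos hl, one_mul]

theorem hasDerivAt_stieltjes {s z : ℝ} (hs : 0 < s) (hz : 2 * s < z) :
    HasDerivAt (stieltjes s) (-stieltjes s z / Real.sqrt (z ^ 2 - 4 * s ^ 2)) z := by
  have hz0 : 0 < z := by linarith
  have hpos : 0 < z ^ 2 - 4 * s ^ 2 := by nlinarith
  have hr : Real.sqrt (z ^ 2 - 4 * s ^ 2) ≠ 0 := (Real.sqrt_pos.2 hpos).ne'
  have hsq : HasDerivAt (fun l : ℝ => l ^ 2 - 4 * s ^ 2) (2 * z) z := by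
    simpa using (hasDerivAt_pow 2 z).sub_const (4 * s ^ 2)
  have hder := ((hasDerivAt_id' z).sub (hsq.sqrt hpos.ne')).div_const (2 * s ^ 2)
  have heq : stieltjes s =ᶠ[nhds z]
      fun l => (l - Real.sqrt (l ^ 2 - 4 * s ^ 2)) / (2 * s ^ 2) := by
    filter_upwards [lt_mem_nhds hz0] with l hl using stieltjes_of_pos s hl
  refine (hder.congr_of_eventuallyEq heq).congr_deriv ?_
  rw [stieltjes_of_pos s hz0]
  field_simp
  ring

theorem one_sub_sq_mul_stieltjes_sq {s z : ℝ} (hs : 0 < s) (hz : 2 * s < z) :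
    1 - s ^ 2 * stieltjes s z ^ 2 = stieltjes s z * Real.sqrt (z ^ 2 - 4 * s ^ 2) := by
  have hsq : Real.sqrt (z ^ 2 - 4 * s ^ 2) ^ 2 = z ^ 2 - 4 * s ^ 2 :=
    Real.sq_sqrt (by nlinarith)
  rw [stieltjes_of_pos s (by linarith)]
  generalize Real.sqrt (z ^ 2 - 4 * s ^ 2) = r at hsq ⊢
  field_simp
  linear_combination hsq

theorem stmt_13 (σH σW σ : ℝ) (hσH : 0 < σH) (hσW : 0 < σW)
    (hσ : σ = Real.sqrt (σH ^ 2 + σW ^ 2)) :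
    ∀ z : ℝ, 2 * σ < z →
      (1 - σW ^ 2 * deriv (stieltjes σ) z) * (1 - σ ^ 2 * stieltjes σ z ^ 2)
        = 1 - σH ^ 2 * stieltjes σ z ^ 2 := by
  intro z hz
  have hsum : 0 < σH ^ 2 + σW ^ 2 := by positivity
  have hσ0 : 0 < σ := hσ ▸ Real.sqrt_pos.2 hsum
  have hσ2 : σ ^ 2 = σH ^ 2 + σW ^ 2 := by rw [hσ, Real.sq_sqrt hsum.le]
  have hr : Real.sqrt (z ^ 2 - 4 * σ ^ 2) ≠ 0 := (Real.sqrt_pos.2 (by nlinarith)).ne'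
  have hderiv : deriv (stieltjes σ) z * (1 - σ ^ 2 * stieltjes σ z ^ 2)
      = -stieltjes σ z ^ 2 := by
    rw [(hasDerivAt_stieltjes hσ0 hz).deriv, one_sub_sq_mul_stieltjes_sq hσ0 hz]
    field_simp
  linear_combination -σW ^ 2 * hderiv - stieltjes σ z ^ 2 * hσ2
end
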